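/- arXiv:2605.02199 — 7 statements merged into one kernel-verified Lean document; each statement's English description precedes it below -/
import Mathlib

section
/- Let U be a finite type and F : Finset U → ℝ a set function. The following are equivalent: (i) the diminishing-returns property: for all finsets S ⊆ T ⊆ U and all u ∉ T, F(insert u S) − F(S) ≥ F(insert u T) − F(T); (ii) the lattice property: for all finsets S, T ⊆ U, F(S) + F(T) ≥ F(S ∪ T) + F(S ∩ T). -/
/-- Diminishing returns for adding one element extends to adding a disjoint finset. -/
theorem sub_le_sub_of_diminishing_returns {U : Type*} [DecidableEq U] {F : Finset U → ℝ}
    (hF : ∀ S T : Finset U, S ⊆ T → ∀ u ∉ T, F (insert u S) - F S ≥ F (insert u T) - F T)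
    {A B : Finset U} (hAB : A ⊆ B) (D : Finset U) (hD : Disjoint D B) :
    F (D ∪ B) - F B ≤ F (D ∪ A) - F A := by
  induction D using Finset.induction_on with
  | empty => simp
  | insert u D hu ih =>
    rw [Finset.disjoint_insert_left] at hD
    have hstep := hF (D ∪ A) (D ∪ B) (Finset.union_subset_union_right hAB) u
      (by simp [hu, hD.1])
    rw [Finset.insert_union, Finset.insert_union]
    linarith [ih hD.2]

/-- **Equivalence of the two definitions of submodularity.**
For a set function `F : Finset U → ℝ` on a finite type `U`, the
diminishing-returns property (for all `S ⊆ T` and `u ∉ T`,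
`F (insert u S) - F S ≥ F (insert u T) - F T`) is equivalent to the lattice
property (for all `S, T`, `F S + F T ≥ F (S ∪ T) + F (S ∩ T)`). -/
theorem submodular_diminishing_returns_iff_lattice
    {U : Type*} [Fintype U] [DecidableEq U] (F : Finset U → ℝ) :
    (∀ S T : Finset U, S ⊆ T → ∀ u ∉ T,
      F (insert u S) - F S ≥ F (insert u T) - F T) ↔
    (∀ S T : Finset U, F S + F T ≥ F (S ∪ T) + F (S ∩ T)) := by
  constructor
  · intro hF S T
    have h := sub_le_sub_of_diminishing_returns hF (Finset.inter_subset_right (s₁ := S) (s₂ := T))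
      (S \ T) Finset.sdiff_disjoint
    rw [Finset.sdiff_union_self_eq_union, Finset.sdiff_union_inter] at h
    linarith
  · intro hF S T hST u hu
    have h := hF (insert u S) T
    rw [Finset.insert_union, Finset.union_eq_right.mpr hST, Finset.insert_inter_of_notMem hu,
      Finset.inter_eq_left.mpr hST] at h
    linarith
end

section
/- For every η > 0 there exists a one-group instance witnessing that the maximum-density representation rule can be arbitrarily bad: there are a budget B = 2, two candidates a and b forming a single experience group, costs c_a = δ and c_b = 1 with δ = min(η/2, 1/4), so that 0 < c_u ≤ B/2 for both candidates, and a modular utility F with F(∅) = 0, F({a}) = 2δ, F({b}) = 1, F({a,b}) = 1 + 2δ, such that: candidate a has strictly larger value-per-cost density than candidate b (F({a})/c_a = 2 > 1 = F({b})/c_b), the feasible optimum over stores containing at most one of the two candidates and of cost at most B equals F({b}) = 1, and the value obtained by selecting the maximum-density candidate satisfies F({a}) = 2δ ≤ η · 1; hence the density rule obtains at most η times the finite package optimum. -/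
/-- **Density-only representation choice can be arbitrarily bad.**
For every `η > 0` there is a one-experience-group modular instance with
budget `B = 2`, two candidates `0` and `1` with costs `c 0 = δ`, `c 1 = 1`
where `δ = min (η/2) (1/4)` (so `0 < c u ≤ B/2` for both), and a modular
utility `F` with `F ∅ = 0`, `F {0} = 2δ`, `F {1} = 1`, `F {0,1} = 1 + 2δ`,
such that candidate `0` has strictly larger density (`2 > 1`), the feasible
optimum over stores keeping at most one of the two candidates with cost at
most `B` equals `1 = F {1}`, and the max-density choice obtains
`F {0} = 2δ ≤ η * 1`. -/
theorem density_only_arbitrarily_bad (η : ℝ) (hη : 0 < η) :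
    ∃ (δ : ℝ) (c v : Fin 2 → ℝ) (F : Finset (Fin 2) → ℝ) (B : ℝ),
      B = 2 ∧
      δ = min (η / 2) (1 / 4) ∧
      c 0 = δ ∧ c 1 = 1 ∧
      (∀ u : Fin 2, 0 < c u ∧ c u ≤ B / 2) ∧
      (∀ X : Finset (Fin 2), F X = ∑ u ∈ X, v u) ∧
      F ∅ = 0 ∧ F {0} = 2 * δ ∧ F {1} = 1 ∧ F ({0, 1} : Finset (Fin 2)) = 1 + 2 * δ ∧
      F {0} / c 0 = 2 ∧ F {1} / c 1 = 1 ∧ F {0} / c 0 > F {1} / c 1 ∧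
      IsGreatest {z : ℝ | ∃ X : Finset (Fin 2),
        X.card ≤ 1 ∧ (∑ u ∈ X, c u) ≤ B ∧ z = F X} (F {1}) ∧
      F {1} = 1 ∧
      F {0} ≤ η * 1 := by
  obtain ⟨δ, hδ⟩ : ∃ δ : ℝ, δ = min (η / 2) (1 / 4) := ⟨_, rfl⟩
  have h_pos : 0 < δ := hδ ▸ lt_min (by linarith) (by norm_num)
  have h_half : δ ≤ η / 2 := hδ ▸ min_le_left _ _
  have h_quarter : δ ≤ 1 / 4 := hδ ▸ min_le_right _ _
  have h_density : 2 * δ / δ = 2 := mul_div_cancel_right₀ 2 h_pos.ne'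
  refine ⟨δ, ![δ, 1], ![2 * δ, 1], fun X => ∑ u ∈ X, ![2 * δ, 1] u, 2, rfl, hδ, rfl, rfl,
    ?_, fun _ => rfl, by simp, by simp, by simp, by simp [add_comm], by simpa using h_density,
    by simp, by simp [h_density], ⟨⟨{1}, by simp, by simp, rfl⟩, ?_⟩, by simp, ?_⟩
  · intro u
    fin_cases u
    · exact ⟨h_pos, by simp; linarith⟩
    · simp
  · rintro z ⟨X, hX, -, rfl⟩
    obtain ⟨u, hu⟩ := Finset.card_le_one_iff_subset_singleton.mp hX
    obtain rfl | rfl := Finset.subset_singleton_iff.mp hu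
    · simp
    · fin_cases u
      · simp; linarith
      · simp
  · simp; linarith
end

section
/- Let U be a finite ground set partitioned into pairwise disjoint groups G_1, …, G_T, with costs c : U → ℝ satisfying 0 < c_u ≤ B/2 for every u, a budget B > 0, and F : Finset U → ℝ normalized, monotone, and submodular. Let OPT be the maximum of F over feasible stores (cost at most B and at most one candidate per group). Fix ε ∈ [0,1] and a threshold λ with (1−ε)·OPT/(2B) ≤ λ ≤ OPT/(2B). Suppose an insertion-only execution processes the groups in order and produces a chain ∅ = X_0 ⊆ X_1 ⊆ ⋯ ⊆ X_T = X such that for each i: X_i \ X_{i−1} ⊆ G_i and |X_i \ X_{i−1}| ≤ 1; if an element x_i is accepted at step i then c(X_{i−1}) + c_{x_i} ≤ B, F(insert x_i X_{i−1}) − F(X_{i−1}) ≥ λ·c_{x_i}, and x_i maximizes the raw marginal F(insert u X_{i−1}) − F(X_{i−1}) over all admissible u ∈ G_i (where u is admissible if c(X_{i−1}) + c_u ≤ B and its marginal gain is at least λ·c_u); and if no element is accepted at step i (X_i = X_{i−1}) then every u ∈ G_i is inadmissible. Then F(X) ≥ (1−ε)·OPT/4. -/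
theorem submodular_union_le_add_sum_marginals {U : Type*} [DecidableEq U] {F : Finset U → ℝ}
    (hmono : ∀ S S' : Finset U, S ⊆ S' → F S ≤ F S')
    (hsub : ∀ S S' : Finset U, S ⊆ S' → ∀ u ∉ S',
      F (insert u S) - F S ≥ F (insert u S') - F S')
    (X O : Finset U) :
    F (X ∪ O) ≤ F X + ∑ o ∈ O, (F (insert o X) - F X) := by
  induction O using Finset.induction_on with
  | empty => simp
  | insert a O ha ih =>
    rw [Finset.sum_insert ha, Finset.union_insert]
    by_cases h : a ∈ X ∪ O
    · rw [Finset.insert_eq_self.2 h]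
      linarith [hmono X (insert a X) (Finset.subset_insert a X)]
    · linarith [hsub X (X ∪ O) Finset.subset_union_left a h]

theorem sum_Icc_one_sub_pred (f : ℕ → ℝ) (n : ℕ) :
    ∑ i ∈ Finset.Icc 1 n, (f i - f (i - 1)) = f n - f 0 := by
  induction n with
  | zero => simp
  | succ n ih =>
    rw [Finset.sum_Icc_succ_top (by omega), ih]
    simp

theorem eq_or_eq_insert_of_card_sdiff_le_one {U : Type*} [DecidableEq U] {A B : Finset U}
    (hAB : A ⊆ B) (hcard : (B \ A).card ≤ 1) :
    B = A ∨ ∃ x ∈ B \ A, B = insert x A := by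
  rcases (B \ A).eq_empty_or_nonempty with h | ⟨x, hx⟩
  · exact Or.inl (Finset.Subset.antisymm (Finset.sdiff_eq_empty_iff_subset.1 h) hAB)
  · refine Or.inr ⟨x, hx, ?_⟩
    have hsingle : B \ A = {x} :=
      Finset.eq_singleton_iff_unique_mem.2
        ⟨hx, fun y hy => Finset.card_le_one.1 hcard y hy x hx⟩
    rw [← Finset.sdiff_union_of_subset hAB, hsingle, Finset.insert_eq]


/-- **Scoped package-oracle grouped value-threshold (GVT) guarantee.**
Let `U` be partitioned into pairwise disjoint groups `G 1, …, G T`, with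
costs `0 < c u ≤ B/2`, budget `B > 0`, and `F` normalized, monotone,
submodular.  Let `OPT` be the maximum of `F` over feasible stores (cost at
most `B`, at most one candidate per group).  Fix `ε ∈ [0,1]` and a threshold
`λ` with `(1-ε)·OPT/(2B) ≤ λ ≤ OPT/(2B)`.  Suppose an insertion-only
execution processes the groups in order, producing a chain
`∅ = X 0 ⊆ X 1 ⊆ ⋯ ⊆ X T` with at most one `G i`-element accepted per step,
accepted elements being budget-feasible, above threshold, and of maximal raw
marginal among threshold-admissible candidates in their group, and rejecting
a group only when every candidate in it is inadmissible.  Then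
`F (X T) ≥ (1-ε)·OPT/4`. -/
theorem gvt_package_oracle_guarantee
    {U : Type*} [Fintype U] [DecidableEq U]
    (T : ℕ) (G : ℕ → Finset U)
    (hdisj : ∀ i ∈ Finset.Icc 1 T, ∀ j ∈ Finset.Icc 1 T, i ≠ j →
      Disjoint (G i) (G j))
    (hcover : (Finset.Icc 1 T).biUnion G = Finset.univ)
    (c : U → ℝ) (B : ℝ) (hB : 0 < B)
    (hc : ∀ u, 0 < c u ∧ c u ≤ B / 2)
    (F : Finset U → ℝ)
    (hF0 : F ∅ = 0)
    (hFmono : ∀ S S' : Finset U, S ⊆ S' → F S ≤ F S')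
    (hFsub : ∀ S S' : Finset U, S ⊆ S' → ∀ u ∉ S',
      F (insert u S) - F S ≥ F (insert u S') - F S')
    (feasible : Finset U → Prop)
    (hfeas : ∀ X : Finset U, feasible X ↔
      (∑ u ∈ X, c u) ≤ B ∧ ∀ i ∈ Finset.Icc 1 T, (X ∩ G i).card ≤ 1)
    (OPT : ℝ)
    (hOPT : IsGreatest {z : ℝ | ∃ X : Finset U, feasible X ∧ z = F X} OPT)
    (ε : ℝ) (hε : ε ∈ Set.Icc (0 : ℝ) 1)
    (lam : ℝ)
    (hlam : (1 - ε) * OPT / (2 * B) ≤ lam ∧ lam ≤ OPT / (2 * B))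
    (X : ℕ → Finset U)
    (hX0 : X 0 = ∅)
    (hchain : ∀ i ∈ Finset.Icc 1 T, X (i - 1) ⊆ X i)
    (hstep : ∀ i ∈ Finset.Icc 1 T,
      X i \ X (i - 1) ⊆ G i ∧ (X i \ X (i - 1)).card ≤ 1)
    (haccept : ∀ i ∈ Finset.Icc 1 T, ∀ x ∈ X i \ X (i - 1),
      (∑ u ∈ X (i - 1), c u) + c x ≤ B ∧
      F (insert x (X (i - 1))) - F (X (i - 1)) ≥ lam * c x ∧
      ∀ u ∈ G i,
        ((∑ u' ∈ X (i - 1), c u') + c u ≤ B ∧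
          F (insert u (X (i - 1))) - F (X (i - 1)) ≥ lam * c u) →
        F (insert u (X (i - 1))) - F (X (i - 1)) ≤
          F (insert x (X (i - 1))) - F (X (i - 1)))
    (hreject : ∀ i ∈ Finset.Icc 1 T, X i = X (i - 1) →
      ∀ u ∈ G i,
        ¬((∑ u' ∈ X (i - 1), c u') + c u ≤ B ∧
          F (insert u (X (i - 1))) - F (X (i - 1)) ≥ lam * c u)) :
    F (X T) ≥ (1 - ε) * OPT / 4 := by
  obtain ⟨⟨O, hO, rfl⟩, -⟩ := hOPT
  obtain ⟨hOcost, hOcard⟩ := (hfeas O).1 hO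
  obtain ⟨hε0, hε1⟩ := hε
  obtain ⟨hlam_lower, hlam_upper⟩ := hlam
  have hOPT0 : 0 ≤ F O := hF0 ▸ hFmono ∅ O (Finset.empty_subset O)
  have hlam0 : 0 ≤ lam :=
    le_trans (div_nonneg (mul_nonneg (by linarith) hOPT0) (by linarith)) hlam_lower
  rw [div_le_iff₀ (by linarith)] at hlam_lower
  rw [le_div_iff₀ (by linarith)] at hlam_upper
  have hcases : ∀ i ∈ Finset.Icc 1 T,
      X i = X (i - 1) ∨ ∃ x ∈ X i \ X (i - 1), X i = insert x (X (i - 1)) := fun i hi =>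
    eq_or_eq_insert_of_card_sdiff_le_one (hchain i hi) (hstep i hi).2
  have hdensity : ∀ n ≤ T, lam * ∑ u ∈ X n, c u ≤ F (X n) := by
    intro n
    induction n with
    | zero => simp [hX0, hF0]
    | succ n ih =>
      intro hn
      have ih := ih (by omega)
      have hi : n + 1 ∈ Finset.Icc 1 T := Finset.mem_Icc.2 ⟨by omega, hn⟩
      rcases hcases _ hi with h | ⟨x, hx, h⟩
      · rw [h]
        exact ih
      · have hgain := (haccept _ hi x hx).2.1
        have hxn := (Finset.mem_sdiff.1 hx).2
        simp only [Nat.add_sub_cancel] at h hgain hxn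
        rw [h, Finset.sum_insert hxn, mul_add]
        linarith
  have hsubset : ∀ n ≤ T, X n ⊆ X T := by
    intro n hn
    induction hn using Nat.decreasingInduction with
    | self => exact subset_rfl
    | of_succ k hk ih =>
      exact (hchain (k + 1) (Finset.mem_Icc.2 ⟨by omega, hk⟩)).trans ih
  by_cases hhalf : B / 2 < ∑ u ∈ X T, c u
  · nlinarith [hdensity T le_rfl, mul_le_mul_of_nonneg_left hhalf.le hlam0]
  push Not at hhalf
  have hmarginal : ∀ i ∈ Finset.Icc 1 T, ∀ u ∈ G i,
      F (insert u (X T)) - F (X T) ≤ lam * c u + (F (X i) - F (X (i - 1))) := by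
    intro i hi u hu
    have hcu := hc u
    have hlamc : 0 ≤ lam * c u := mul_nonneg hlam0 hcu.1.le
    have hgain := hFmono _ _ (hchain i hi)
    by_cases huX : u ∈ X T
    · rw [Finset.insert_eq_self.2 huX]
      linarith
    have hsub : X (i - 1) ⊆ X T :=
      hsubset (i - 1) (by have := (Finset.mem_Icc.1 hi).2; omega)
    have hdecr := hFsub _ _ hsub u huX
    have hcost : ∑ v ∈ X (i - 1), c v ≤ ∑ v ∈ X T, c v :=
      Finset.sum_le_sum_of_subset_of_nonneg hsub fun v _ _ => (hc v).1.le
    by_cases hadm : F (insert u (X (i - 1))) - F (X (i - 1)) ≥ lam * c u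
    · rcases hcases i hi with h | ⟨x, hx, h⟩
      · exact absurd ⟨by linarith, hadm⟩ (hreject i hi h u hu)
      · have hmax := (haccept i hi x hx).2.2 u hu ⟨by linarith, hadm⟩
        rw [← h] at hmax
        linarith
    · linarith
  have hOdisj : (↑(Finset.Icc 1 T) : Set ℕ).PairwiseDisjoint fun i => O ∩ G i :=
    fun i hi j hj hij =>
      (hdisj i hi j hj hij).mono Finset.inter_subset_right Finset.inter_subset_right
  have hOcover : (Finset.Icc 1 T).biUnion (fun i => O ∩ G i) = O := by
    rw [← Finset.inter_biUnion, hcover, Finset.inter_univ]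
  have hsum : ∑ o ∈ O, (F (insert o (X T)) - F (X T)) ≤ lam * ∑ o ∈ O, c o + F (X T) := by
    have htelescope := sum_Icc_one_sub_pred (fun i => F (X i)) T
    rw [hX0, hF0, sub_zero] at htelescope
    rw [Finset.mul_sum]
    conv_lhs => rw [← hOcover]
    conv_rhs => rw [← htelescope, ← hOcover]
    rw [Finset.sum_biUnion hOdisj, Finset.sum_biUnion hOdisj, ← Finset.sum_add_distrib]
    refine Finset.sum_le_sum fun i hi => ?_
    refine (Finset.sum_le_sum fun u hu =>
      hmarginal i hi u (Finset.mem_inter.1 hu).2).trans ?_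
    rw [Finset.sum_add_distrib, Finset.sum_const, nsmul_eq_mul]
    have hcard : ((O ∩ G i).card : ℝ) ≤ 1 := by exact_mod_cast hOcard i hi
    have hgain := hFmono _ _ (hchain i hi)
    gcongr
    exact mul_le_of_le_one_left (by linarith) hcard
  have hunion := submodular_union_le_add_sum_marginals hFmono hFsub (X T) O
  have hle := hFmono O (X T ∪ O) Finset.subset_union_right
  have hcost := mul_le_mul_of_nonneg_left hOcost hlam0
  nlinarith [mul_nonneg hε0 hOPT0]
end

section
/- Let U be a finite type and F : Finset U → ℝ monotone and submodular. Then for all finsets S, T ⊆ U, F(T) ≤ F(S) + Σ_{u ∈ T \ S} (F(insert u S) − F(S)); that is, the value of any target set is bounded by the value of the current set plus the sum of the current marginal gains of the missing elements. -/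
/-- A submodular set function gains at most the sum of the marginal gains at `S` when a set `A`
disjoint from `S` is added to `S`. -/
theorem le_add_sum_marginal_of_disjoint {U : Type*} [DecidableEq U] {F : Finset U → ℝ}
    (hF : ∀ S T : Finset U, S ⊆ T → ∀ u ∉ T, F (insert u S) - F S ≥ F (insert u T) - F T)
    {S A : Finset U} (hSA : Disjoint S A) :
    F (S ∪ A) ≤ F S + ∑ u ∈ A, (F (insert u S) - F S) := by
  induction A using Finset.induction_on with
  | empty => simp
  | insert a A ha ih =>
    obtain ⟨haS, hSA⟩ := Finset.disjoint_insert_right.mp hSA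
    have hgain := hF S (S ∪ A) Finset.subset_union_left a (by simp [haS, ha])
    rw [Finset.sum_insert ha, Finset.union_insert]
    linarith [ih hSA]

/-- **Submodular charging bound.**
If `F : Finset U → ℝ` is monotone and submodular, then for all finsets
`S, T`, `F T ≤ F S + ∑ u ∈ T \ S, (F (insert u S) - F S)`: the value of any
target set is bounded by the value of the current set plus the sum of the
current marginal gains of the missing elements. -/
theorem submodular_charging_bound
    {U : Type*} [Fintype U] [DecidableEq U]
    (F : Finset U → ℝ)
    (hFmono : ∀ S T : Finset U, S ⊆ T → F S ≤ F T)
    (hFsub : ∀ S T : Finset U, S ⊆ T → ∀ u ∉ T,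
      F (insert u S) - F S ≥ F (insert u T) - F T)
    (S T : Finset U) :
    F T ≤ F S + ∑ u ∈ T \ S, (F (insert u S) - F S) := by
  calc F T ≤ F (S ∪ T \ S) := hFmono _ _ (by simp)
    _ ≤ F S + ∑ u ∈ T \ S, (F (insert u S) - F S) :=
      le_add_sum_marginal_of_disjoint hFsub Finset.disjoint_sdiff
end

section
/- Let U be a finite type, F : Finset U → ℝ monotone and submodular, X and O finsets in U, λ ∈ ℝ, and B > 0. Suppose the total marginal charge of the missing optimal elements satisfies Σ_{u ∈ O \ X} (F(insert u X) − F(X)) ≤ λ·B + F(X), and that λ·B ≤ F(O)/2. Then F(X) ≥ F(O)/4. -/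
/-- For a submodular `F`, the total gain of adding `S` to a disjoint `X` is at most the sum of the
marginal gains at `X` of the elements of `S`. -/
theorem submodular_union_sub_le_sum_marginals {U : Type*} [DecidableEq U] {F : Finset U → ℝ}
    (hF : ∀ S T : Finset U, S ⊆ T → ∀ u ∉ T, F (insert u S) - F S ≥ F (insert u T) - F T)
    {X S : Finset U} (hXS : Disjoint X S) :
    F (X ∪ S) - F X ≤ ∑ u ∈ S, (F (insert u X) - F X) := by
  induction S using Finset.induction_on with
  | empty => simp
  | insert a S ha ih =>
    rw [Finset.disjoint_insert_right] at hXS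
    have hgain := hF X (X ∪ S) Finset.subset_union_left a (by simp [hXS.1, ha])
    rw [Finset.sum_insert ha, Finset.union_insert]
    linarith [ih hXS.2]

/-- **Quarter-optimal bound from the combined charges.**
Let `F` be monotone and submodular, `X` and `O` finsets, `λ ∈ ℝ`, `B > 0`.
If `∑ u ∈ O \ X, (F (insert u X) - F X) ≤ λ·B + F X` and `λ·B ≤ F O / 2`,
then `F X ≥ F O / 4`. -/
theorem quarter_optimal_from_charges
    {U : Type*} [Fintype U] [DecidableEq U]
    (F : Finset U → ℝ)
    (hFmono : ∀ S T : Finset U, S ⊆ T → F S ≤ F T)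
    (hFsub : ∀ S T : Finset U, S ⊆ T → ∀ u ∉ T,
      F (insert u S) - F S ≥ F (insert u T) - F T)
    (X O : Finset U) (lam B : ℝ) (hB : 0 < B)
    (hcharge : ∑ u ∈ O \ X, (F (insert u X) - F X) ≤ lam * B + F X)
    (hlamB : lam * B ≤ F O / 2) :
    F X ≥ F O / 4 := by
  have hgain := submodular_union_sub_le_sum_marginals hFsub (Finset.disjoint_sdiff (s := X) (t := O))
  rw [Finset.union_sdiff_self_eq_union] at hgain
  linarith [hFmono O (X ∪ O) Finset.subset_union_right]
end

section
/- Let U be a finite type, F : Finset U → ℝ with F(∅) = 0, c : U → ℝ, B > 0, ε ∈ [0,1], and OPT ≥ 0. Suppose x_1, …, x_k are distinct elements with chain X_0 = ∅, X_i = X_{i−1} ∪ {x_i} satisfying F(X_i) − F(X_{i−1}) ≥ λ·c_{x_i} for every i, where λ ≥ (1−ε)·OPT/(2B), and suppose the total cost satisfies Σ_{i=1}^{k} c_{x_i} ≥ B/2. Then F(X_k) ≥ (1−ε)·OPT/4. -/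
/-- If every increment of `f` up to `k` is at least `r` times the corresponding weight, then the
total increment is at least `r` times the total weight. -/
theorem mul_sum_Icc_le_sub {r : ℝ} {k : ℕ} (f w : ℕ → ℝ)
    (h : ∀ i ∈ Finset.Icc 1 k, r * w i ≤ f i - f (i - 1)) :
    r * ∑ i ∈ Finset.Icc 1 k, w i ≤ f k - f 0 := by
  induction k with
  | zero => simp
  | succ n ih =>
    have hn := ih fun i hi => h i (Finset.Icc_subset_Icc_right n.le_succ hi)
    have hlast := h (n + 1) (by simp)
    rw [Nat.add_sub_cancel] at hlast
    rw [Finset.sum_Icc_succ_top (by omega), mul_add]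
    linarith


/-- **First case of the GVT analysis: large-cost stores are near-optimal.**
Let `F ∅ = 0`, `B > 0`, `ε ∈ [0,1]`, `OPT ≥ 0`, and let distinct elements
`x 1, …, x k` form the insertion chain `X 0 = ∅`, `X i = X (i-1) ∪ {x i}`
with each marginal gain at least `λ · c (x i)` for a threshold
`λ ≥ (1-ε)·OPT/(2B)`.  If the total cost satisfies
`∑ i, c (x i) ≥ B/2`, then `F (X k) ≥ (1-ε)·OPT/4`. -/
theorem gvt_first_case_half_budget
    {U : Type*} [Fintype U] [DecidableEq U]
    (F : Finset U → ℝ) (hF0 : F ∅ = 0)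
    (c : U → ℝ) (B : ℝ) (hB : 0 < B)
    (ε : ℝ) (hε : ε ∈ Set.Icc (0 : ℝ) 1)
    (OPT : ℝ) (hOPT : 0 ≤ OPT)
    (lam : ℝ) (hlam : (1 - ε) * OPT / (2 * B) ≤ lam)
    (k : ℕ) (x : ℕ → U) (hinj : Set.InjOn x (Set.Icc 1 k))
    (X : ℕ → Finset U) (hX0 : X 0 = ∅)
    (hXi : ∀ i ∈ Finset.Icc 1 k, X i = X (i - 1) ∪ {x i})
    (hgain : ∀ i ∈ Finset.Icc 1 k,
      F (X i) - F (X (i - 1)) ≥ lam * c (x i))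
    (hcost : B / 2 ≤ ∑ i ∈ Finset.Icc 1 k, c (x i)) :
    F (X k) ≥ (1 - ε) * OPT / 4 := by
  have hlam0 : 0 ≤ lam :=
    le_trans (div_nonneg (mul_nonneg (sub_nonneg.2 hε.2) hOPT) (by positivity)) hlam
  have hvalue : lam * ∑ i ∈ Finset.Icc 1 k, c (x i) ≤ F (X k) := by
    have h := mul_sum_Icc_le_sub (fun i => F (X i)) (fun i => c (x i)) hgain
    simpa [hX0, hF0] using h
  calc (1 - ε) * OPT / 4 = (1 - ε) * OPT / (2 * B) * (B / 2) := by field_simp; norm_num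
    _ ≤ lam * (B / 2) := by gcongr
    _ ≤ lam * ∑ i ∈ Finset.Icc 1 k, c (x i) := by gcongr
    _ ≤ F (X k) := hvalue
end

section
/- Let U be a finite type, F : Finset U → ℝ monotone and submodular, c : U → ℝ with c_u > 0 for all u, and let S ⊆ X be finsets with X \ S nonempty. Then F(X) ≤ F(S) + (Σ_{u ∈ X \ S} c_u) · max_{u ∈ X \ S} ((F(insert u S) − F(S)) / c_u). In particular, any feasible extension of a partial store S whose added cost is at most a remaining budget B' satisfies F(X) ≤ F(S) + B' · max_{u ∈ X \ S} ((F(insert u S) − F(S)) / c_u) whenever all these marginal densities are nonnegative. -/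
/-- A submodular set function gains at most the sum of its single-element marginal gains. -/
theorem submodular_union_le_add_sum_marginal
    {U : Type*} [DecidableEq U] (F : Finset U → ℝ)
    (hFsub : ∀ S T : Finset U, S ⊆ T → ∀ u ∉ T,
      F (insert u S) - F S ≥ F (insert u T) - F T)
    (S A : Finset U) (hdisj : Disjoint S A) :
    F (S ∪ A) ≤ F S + ∑ u ∈ A, (F (insert u S) - F S) := by
  induction A using Finset.induction_on with
  | empty => simp
  | insert a A ha ih =>
    rw [Finset.disjoint_insert_right] at hdisj
    have hgain := hFsub S (S ∪ A) Finset.subset_union_left a (by simp [ha, hdisj.1])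
    rw [Finset.sum_insert ha, Finset.union_insert]
    linarith [ih hdisj.2]

/-- **Admissible optimistic density bound for branch-and-bound pruning.**
Let `F` be monotone and submodular, `c` strictly positive, and `S ⊆ X` with
`X \ S` nonempty.  Then
`F X ≤ F S + (∑ u ∈ X \ S, c u) · max_{u ∈ X \ S} (F (insert u S) - F S)/c u`.
In particular, if the added cost is at most a remaining budget `B'` and all
these marginal densities are nonnegative, then
`F X ≤ F S + B' · max_{u ∈ X \ S} (F (insert u S) - F S)/c u`. -/
theorem optimistic_density_bound
    {U : Type*} [Fintype U] [DecidableEq U]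
    (F : Finset U → ℝ)
    (hFmono : ∀ S T : Finset U, S ⊆ T → F S ≤ F T)
    (hFsub : ∀ S T : Finset U, S ⊆ T → ∀ u ∉ T,
      F (insert u S) - F S ≥ F (insert u T) - F T)
    (c : U → ℝ) (hc : ∀ u, 0 < c u)
    (S X : Finset U) (hSX : S ⊆ X) (hne : (X \ S).Nonempty) :
    F X ≤ F S + (∑ u ∈ X \ S, c u) *
      (X \ S).sup' hne (fun u => (F (insert u S) - F S) / c u) ∧
    ∀ B' : ℝ, (∑ u ∈ X \ S, c u) ≤ B' →
      (∀ u ∈ X \ S, 0 ≤ (F (insert u S) - F S) / c u) →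
      F X ≤ F S + B' *
        (X \ S).sup' hne (fun u => (F (insert u S) - F S) / c u) := by
  have hbound : F X ≤ F S + (∑ u ∈ X \ S, c u) *
      (X \ S).sup' hne (fun u => (F (insert u S) - F S) / c u) := by
    have hsum := submodular_union_le_add_sum_marginal F hFsub S (X \ S) Finset.disjoint_sdiff
    rw [Finset.union_sdiff_of_subset hSX] at hsum
    refine hsum.trans ?_
    rw [Finset.sum_mul]
    gcongr with u hu
    rw [mul_comm, ← div_le_iff₀ (hc u)]
    exact Finset.le_sup' (fun u => (F (insert u S) - F S) / c u) hu
  refine ⟨hbound, fun B' hB hnonneg => hbound.trans ?_⟩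
  obtain ⟨u, hu⟩ := hne
  have hsup := (hnonneg u hu).trans
    (Finset.le_sup' (fun u => (F (insert u S) - F S) / c u) hu)
  gcongr
end
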